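/- Let A ∈ ℝ^{n×n} be symmetric with ‖A‖₂ ≤ 1, let v_1 be a unit eigenvector of A associated with its largest eigenvalue λ_1(A), and let T ≥ 1 and μ ∈ (0, 1/2]. Run Oja's algorithm with constant input A_t = A: w_1 a unit vector in ℝ^n with v_1ᵀ w_1 ≠ 0, z_t = w_t/‖w_t‖₂, w_{t+1} = (I + μ A) w_t. Then max_{t∈[T]} z_tᵀ A z_t ≥ (1/T) Σ_{t=1}^T z_tᵀ A z_t ≥ λ_1(A) − 3μ/2 + ln((v_1ᵀ z_1)²)/(2μT). -/

import Mathlib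

open Matrix

/-- The spectral norm (largest singular value) of a real square matrix, i.e. the operator norm
of the induced linear map on Euclidean space. -/
noncomputable def specNorm {n : ℕ} (A : Matrix (Fin n) (Fin n) ℝ) : ℝ :=
  ‖Matrix.toEuclideanCLM (𝕜 := ℝ) A‖

theorem log_aux (x : ℝ) (h1 : -(1/2) ≤ x) : x - x ^ 2 ≤ Real.log (1 + x) := by
  rcases le_or_gt 0 x with h | h
  · have h2 := Real.one_sub_inv_le_log_of_pos (show (0:ℝ) < 1 + x by linarith)
    refine le_trans ?_ h2
    have : 1 - (1 + x)⁻¹ - (x - x ^ 2) = x ^ 3 / (1 + x) := by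
      field_simp
      ring
    have : 0 ≤ x ^ 3 / (1 + x) := by positivity
    linarith
  · obtain ⟨u, rfl⟩ : ∃ u, x = -u := ⟨-x, by ring⟩
    have hu : 0 < u := by linarith
    have hu2 : u ≤ 1 / 2 := by linarith
    have h3 := Real.abs_log_sub_add_sum_range_le (x := u) (by rw [abs_of_pos hu]; linarith) 4
    rw [abs_of_pos hu] at h3
    have h4 := (abs_le.mp h3).1
    simp only [Finset.sum_range_succ, Finset.sum_range_zero] at h4
    norm_num at h4
    have h5 : u ^ 5 / (1 - u) ≤ 2 * u ^ 5 := by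
      rw [div_le_iff₀ (by linarith)]
      nlinarith [pow_pos hu 5]
    have e : 1 + -u = 1 - u := by ring
    rw [e]
    have h6 : u ^ 3 ≤ u ^ 2 / 2 := by nlinarith [pow_pos hu 2]
    have h7 : u ^ 4 ≤ u ^ 2 / 4 := by nlinarith [pow_pos hu 3]
    have h8 : u ^ 5 ≤ u ^ 2 / 8 := by nlinarith [pow_pos hu 4]
    nlinarith

theorem seq_aux (T : ℕ) (hT : 1 ≤ T) (μ : ℝ) (hμ0 : 0 < μ) (hμ : μ ≤ 1 / 2) (l : ℝ)
    (hl : -1 ≤ l) (hl2 : l ≤ 1) (N a b c : ℕ → ℝ) (h0 : N 0 = 1) (hc0 : c 0 ≠ 0)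
    (hb : ∀ t, b t ≤ N t) (hcN : ∀ t, c t ^ 2 ≤ N t)
    (hN : ∀ t, N (t + 1) = N t + 2 * μ * a t + μ ^ 2 * b t)
    (hc : ∀ t, c (t + 1) = (1 + μ * l) * c t) :
    l - 3 * μ / 2 + Real.log (c 0 ^ 2) / (2 * μ * T)
      ≤ (1 / T : ℝ) * ∑ t ∈ Finset.range T, a t / N t := by
  have hml : -(1/2) ≤ μ * l := by nlinarith
  have hp : 0 < 1 + μ * l := by linarith
  have hcp : ∀ t, c t = (1 + μ * l) ^ t * c 0 := by
    intro t
    induction t with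
    | zero => simp
    | succ k ih => rw [hc, ih]; ring
  have hNp : ∀ t, 0 < N t := by
    intro t
    refine lt_of_lt_of_le ?_ (hcN t)
    rw [hcp]
    positivity
  have hup : ∀ t : ℕ, Real.log (N t) ≤ 2 * μ * ∑ s ∈ Finset.range t, a s / N s + t * μ ^ 2 := by
    intro t
    induction t with
    | zero => simp [h0]
    | succ k ih =>
      have hk := hNp k
      have h1 : Real.log (N (k + 1) / N k) ≤ N (k + 1) / N k - 1 :=
        Real.log_le_sub_one_of_pos (div_pos (hNp _) hk)
      rw [Real.log_div (hNp _).ne' hk.ne'] at h1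
      have h2 : N (k + 1) / N k - 1 = 2 * μ * (a k / N k) + μ ^ 2 * (b k / N k) := by
        rw [hN]; field_simp; ring
      have h3 : b k / N k ≤ 1 := (div_le_one hk).2 (hb k)
      rw [Finset.sum_range_succ]
      push_cast
      nlinarith [sq_nonneg μ]
  have hlow : Real.log (c T ^ 2) ≤ Real.log (N T) := by
    apply Real.log_le_log _ (hcN T)
    rw [hcp]
    positivity
  rw [hcp, mul_pow, Real.log_mul (by positivity) (by positivity), ← pow_mul, Real.log_pow] at hlow
  have hlog := log_aux (μ * l) hml
  have hu := hup T
  have hTp : (0:ℝ) < T := by exact_mod_cast hT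
  push_cast at hlow
  have hl3 : (μ * l) ^ 2 ≤ μ ^ 2 := by
    rw [mul_pow]
    have : l ^ 2 ≤ 1 := by nlinarith
    nlinarith [sq_nonneg μ]
  have key : T * 2 * (μ * l - μ ^ 2) + Real.log (c 0 ^ 2)
      ≤ 2 * μ * ∑ s ∈ Finset.range T, a s / N s + T * μ ^ 2 := by
    have : T * 2 * (μ * l - μ ^ 2) ≤ T * 2 * Real.log (1 + μ * l) := by gcongr; linarith
    linarith
  generalize Real.log (c 0 ^ 2) = L at *
  generalize (∑ s ∈ Finset.range T, a s / N s) = S at *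
  have e : (1 / T : ℝ) * S - (l - 3 * μ / 2 + L / (2 * μ * T))
     = (2 * μ * S + T * μ ^ 2 - (T * 2 * (μ * l - μ ^ 2) + L)) / (2 * μ * T) := by
    field_simp; ring
  have : 0 ≤ (2 * μ * S + T * μ ^ 2 - (T * 2 * (μ * l - μ ^ 2) + L)) / (2 * μ * T) := by
    apply div_nonneg
    · linarith
    · positivity
  linarith

theorem dot_self_aux {n : ℕ} (x : EuclideanSpace ℝ (Fin n)) : x.ofLp ⬝ᵥ x.ofLp = ‖x‖ ^ 2 := by
  rw [← real_inner_self_eq_norm_sq, EuclideanSpace.inner_eq_star_dotProduct]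
  simp

theorem dot_aux {n : ℕ} (x y : EuclideanSpace ℝ (Fin n)) : x.ofLp ⬝ᵥ y.ofLp = inner ℝ x y := by
  rw [EuclideanSpace.inner_eq_star_dotProduct, dotProduct_comm]
  simp

theorem norm_aux {n : ℕ} (A : Matrix (Fin n) (Fin n) ℝ) (hAn : specNorm A ≤ 1)
    (x : EuclideanSpace ℝ (Fin n)) : A.mulVec x.ofLp ⬝ᵥ A.mulVec x.ofLp ≤ x.ofLp ⬝ᵥ x.ofLp := by
  have h := (Matrix.toEuclideanCLM (𝕜 := ℝ) A).le_of_opNorm_le hAn x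
  have e : A.mulVec x.ofLp = (Matrix.toEuclideanCLM (𝕜 := ℝ) A x).ofLp := by simp
  rw [e, dot_self_aux, dot_self_aux]
  rw [one_mul] at h
  gcongr

/-- **Leading eigenvalue approximation via Oja's algorithm run on the constant sequence
`A_t = A` (Section 3.1).**  Here `v1` is a unit eigenvector of the symmetric matrix `A`
associated with its largest eigenvalue `l1 = λ₁(A)` (the hypothesis `hmax` states that `l1`
dominates every eigenvalue).  Indices are shifted so that `w 0` is the paper's `w_1` and
`z 0 = z_1`.  The conclusion states
`max_{t∈[T]} z_tᵀAz_t ≥ (1/T) ∑_t z_tᵀAz_t ≥ λ₁(A) - 3μ/2 + ln((v₁ᵀz₁)²)/(2μT)`. -/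
theorem oja_leading_eigenvalue (n T : ℕ) (hT : 1 ≤ T) (μ : ℝ) (hμ0 : 0 < μ) (hμ : μ ≤ 1 / 2)
    (A : Matrix (Fin n) (Fin n) ℝ) (hA : A.IsSymm) (hAn : specNorm A ≤ 1)
    (v1 : EuclideanSpace ℝ (Fin n)) (hv1 : ‖v1‖ = 1) (l1 : ℝ)
    (heig : A.mulVec v1 = l1 • v1)
    (hmax : ∀ (c : ℝ) (u : EuclideanSpace ℝ (Fin n)), u ≠ 0 → A.mulVec u = c • u → c ≤ l1)
    (w : ℕ → EuclideanSpace ℝ (Fin n)) (hw1 : ‖w 0‖ = 1) (hinit : v1 ⬝ᵥ w 0 ≠ 0)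
    (hrec : ∀ t, w (t + 1) = (1 + μ • A).mulVec (w t))
    (z : ℕ → EuclideanSpace ℝ (Fin n)) (hz : ∀ t, z t = ‖w t‖⁻¹ • w t) :
    l1 - 3 * μ / 2 + Real.log ((v1 ⬝ᵥ z 0) ^ 2) / (2 * μ * T)
        ≤ (1 / T : ℝ) * ∑ t ∈ Finset.range T, z t ⬝ᵥ A.mulVec (z t) ∧
    (1 / T : ℝ) * ∑ t ∈ Finset.range T, z t ⬝ᵥ A.mulVec (z t)
        ≤ (Finset.range T).sup' (Finset.nonempty_range_iff.mpr (by omega))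
            (fun t => z t ⬝ᵥ A.mulVec (z t)) := by
  have hsymm : ∀ x y : Fin n → ℝ, x ⬝ᵥ A.mulVec y = A.mulVec x ⬝ᵥ y := by
    intro x y
    rw [Matrix.dotProduct_mulVec, ← Matrix.mulVec_transpose, hA]
  have hrec' : ∀ t, (w (t + 1)).ofLp = (w t).ofLp + μ • A.mulVec (w t).ofLp := by
    intro t
    rw [hrec, Matrix.add_mulVec, Matrix.one_mulVec, Matrix.smul_mulVec]
  have heig' : A.mulVec v1.ofLp = l1 • v1.ofLp := heig
  have hvv : v1.ofLp ⬝ᵥ v1.ofLp = 1 := by rw [dot_self_aux, hv1]; norm_num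
  have hl : l1 ^ 2 ≤ 1 := by
    have := norm_aux A hAn v1
    rw [heig', smul_dotProduct, dotProduct_smul, hvv] at this
    simp only [smul_eq_mul] at this
    linarith
  have hza : ∀ t, z t ⬝ᵥ A.mulVec (z t)
      = ((w t).ofLp ⬝ᵥ A.mulVec (w t).ofLp) / ((w t).ofLp ⬝ᵥ (w t).ofLp) := by
    intro t
    rw [hz, dot_self_aux, WithLp.ofLp_smul, Matrix.mulVec_smul, smul_dotProduct, dotProduct_smul]
    simp only [smul_eq_mul]
    rw [div_eq_mul_inv, ← inv_pow]
    ring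
  have hz0 : z 0 = w 0 := by rw [hz, hw1]; simp
  constructor
  · rw [hz0]
    simp only [hza]
    refine seq_aux T hT μ hμ0 hμ l1 (by nlinarith) (by nlinarith)
      (fun t => (w t).ofLp ⬝ᵥ (w t).ofLp) (fun t => (w t).ofLp ⬝ᵥ A.mulVec (w t).ofLp)
      (fun t => A.mulVec (w t).ofLp ⬝ᵥ A.mulVec (w t).ofLp)
      (fun t => v1.ofLp ⬝ᵥ (w t).ofLp) ?_ hinit (fun t => norm_aux A hAn _) ?_ ?_ ?_
    · simp only [dot_self_aux, hw1]; norm_num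
    · intro t
      simp only [dot_self_aux, dot_aux v1]
      have := abs_real_inner_le_norm v1 (w t)
      rw [hv1, one_mul] at this
      rw [← sq_abs]
      gcongr
    · intro t
      simp only [hrec', add_dotProduct, dotProduct_add, smul_dotProduct, dotProduct_smul,
        smul_eq_mul, dotProduct_comm (A.mulVec (w t).ofLp) (w t).ofLp]
      ring
    · intro t
      simp only [hrec', dotProduct_add, dotProduct_smul, hsymm, heig', smul_dotProduct,
        smul_eq_mul]
      ring
  · have hTp : (0:ℝ) < T := by exact_mod_cast hT
    rw [one_div, inv_mul_le_iff₀ hTp]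
    have h := Finset.sum_le_card_nsmul (Finset.range T) (fun t => z t ⬝ᵥ A.mulVec (z t))
      ((Finset.range T).sup' (Finset.nonempty_range_iff.mpr (by omega))
        (fun t => z t ⬝ᵥ A.mulVec (z t)))
      (fun t ht => Finset.le_sup' (fun t => z t ⬝ᵥ A.mulVec (z t)) ht)
    rw [Finset.card_range, nsmul_eq_mul] at h
    exact h
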